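/- Let Q be a POST channel, let n and k be positive integers, and let P_{X^{kn+n−1} Y_0} be any joint pmf on 𝒳^{kn+n−1} × 𝒴, with the induced law P(x^{kn+n−1}, y_0) ∏_{t=1}^{kn+n−1} Q(y_t|x_t, y_{t−1}). Then n · I(X^{kn+n−1}; Y^{kn+n−1} | Y_0) ≤ n(n−1) log|𝒳| + ∑_{i=1}^{n} ∑_{j=1}^{k} I( X_{(j−1)n+i}^{jn+i−1} ; Y_{(j−1)n+i}^{jn+i−1} | Y_{(j−1)n+i−1} ), where X_a^b denotes the block (X_a, X_{a+1}, …, X_b) and similarly for Y. -/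

import Mathlib

open scoped BigOperators

noncomputable section

/-- Conditional mutual information `I(A;B|C)` for a joint pmf `P` on finite types,
with the conventions `0 · log 0 = 0` (and division by zero equal to zero)
and natural logarithm. -/
def condMI {A B C : Type*} [Fintype A] [Fintype B] [Fintype C]
    (P : A → B → C → ℝ) : ℝ :=
  ∑ a : A, ∑ b : B, ∑ c : C,
    P a b c *
      Real.log ((P a b c * ∑ a' : A, ∑ b' : B, P a' b' c) /
        ((∑ b' : B, P a b' c) * (∑ a' : A, P a' b c)))

/-- `Q x y' y` represents the POST-channel transition kernel `Q(y | x, y')`. -/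
def IsPOST {X Y : Type*} [Fintype X] [Fintype Y] (Q : X → Y → Y → ℝ) : Prop :=
  (∀ x y' y, 0 ≤ Q x y' y) ∧ ∀ x y', ∑ y : Y, Q x y' y = 1

/-- A joint pmf `P(x, y')` on `X × Y`. -/
def IsJointPmf {X Y : Type*} [Fintype X] [Fintype Y] (P : X → Y → ℝ) : Prop :=
  (∀ x y, 0 ≤ P x y) ∧ ∑ x : X, ∑ y : Y, P x y = 1

/-- The stationarity constraint `∑_{x,y'} P(x,y') Q(y|x,y') = ∑_x P(x,y)` for all `y`. -/
def StationaryFor {X Y : Type*} [Fintype X] [Fintype Y]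
    (Q : X → Y → Y → ℝ) (P : X → Y → ℝ) : Prop :=
  ∀ y : Y, ∑ x : X, ∑ y' : Y, P x y' * Q x y' y = ∑ x : X, P x y

/-- `I(X;Y|Y')` computed under the joint law `P(x,y') Q(y|x,y')`. -/
def fbMI {X Y : Type*} [Fintype X] [Fintype Y]
    (Q : X → Y → Y → ℝ) (P : X → Y → ℝ) : ℝ :=
  condMI (fun (x : X) (y : Y) (y' : Y) => P x y' * Q x y' y)

/-- `P` is a maximizer of the optimization problem defining `C*_f(Q)`. -/
def IsFbMaximizer {X Y : Type*} [Fintype X] [Fintype Y]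
    (Q : X → Y → Y → ℝ) (P : X → Y → ℝ) : Prop :=
  IsJointPmf P ∧ StationaryFor Q P ∧
    ∀ P' : X → Y → ℝ, IsJointPmf P' → StationaryFor Q P' → fbMI Q P' ≤ fbMI Q P

/-- The feedback capacity functional `C*_f(Q)`. -/
def Cfstar {X Y : Type*} [Fintype X] [Fintype Y] (Q : X → Y → Y → ℝ) : ℝ :=
  sSup {r : ℝ | ∃ P : X → Y → ℝ, IsJointPmf P ∧ StationaryFor Q P ∧ fbMI Q P = r}

/-- The state preceding time `t` in a length-`n` block with initial state `y0`. -/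
def prevState {Y : Type*} (n : ℕ) (y0 : Y) (ys : Fin n → Y) (t : Fin n) : Y :=
  if (t : ℕ) = 0 then y0
  else ys ⟨(t : ℕ) - 1, lt_of_le_of_lt (Nat.sub_le _ _) t.isLt⟩

/-- A joint pmf `P(x^n, y_0)` on `𝒳^n × 𝒴`. -/
def IsJointPmfN {X Y : Type*} [Fintype X] [Fintype Y] (n : ℕ)
    (P : (Fin n → X) → Y → ℝ) : Prop :=
  (∀ xs y0, 0 ≤ P xs y0) ∧ ∑ xs : Fin n → X, ∑ y0 : Y, P xs y0 = 1

/-- The induced joint law `P(x^n,y_0) ∏_{t=1}^n Q(y_t|x_t,y_{t-1})`. -/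
def nLaw {X Y : Type*} [Fintype X] [Fintype Y]
    (Q : X → Y → Y → ℝ) (n : ℕ) (P : (Fin n → X) → Y → ℝ) :
    (Fin n → X) → (Fin n → Y) → Y → ℝ :=
  fun xs ys y0 => P xs y0 * ∏ t : Fin n, Q (xs t) (prevState n y0 ys t) (ys t)

/-- `C_n(Q) = (1/n) max_{P_{X^n Y_0}} I(X^n; Y^n | Y_0)`. -/
def Cn {X Y : Type*} [Fintype X] [Fintype Y] (Q : X → Y → Y → ℝ) (n : ℕ) : ℝ :=
  sSup {r : ℝ | ∃ P : (Fin n → X) → Y → ℝ, IsJointPmfN n P ∧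
    r = (1 / (n : ℝ)) * condMI (nLaw Q n P)}

/-- A pmf on a finite set. -/
def IsPmf {X : Type*} [Fintype X] (p : X → ℝ) : Prop :=
  (∀ x, 0 ≤ p x) ∧ ∑ x : X, p x = 1

/-- The mutual information `I(X;Y)` across the memoryless channel `W` with input pmf `p`. -/
def mlMI {X Y : Type*} [Fintype X] [Fintype Y] (W : X → Y → ℝ) (p : X → ℝ) : ℝ :=
  ∑ x : X, ∑ y : Y, p x * W x y * Real.log (W x y / ∑ x' : X, p x' * W x' y)

/-- The conditional output kernel `P_{Y|Y'}(y|y') = ∑_x P_{X|Y'}(x|y') Q(y|x,y')`. -/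
def condOut {X Y : Type*} [Fintype X] [Fintype Y]
    (Q : X → Y → Y → ℝ) (P : X → Y → ℝ) (y' y : Y) : ℝ :=
  (∑ x : X, P x y' * Q x y' y) / (∑ x : X, P x y')

/-- The marginal law of a block of coordinates (selected by `f`) of `(X^N, Y^N)`
together with a conditioning variable extracted by `g`, under the joint law `μ`. -/
def blockMarginal {X Y : Type*} [Fintype X] [Fintype Y] [DecidableEq X] [DecidableEq Y]
    {N n : ℕ} (μ : (Fin N → X) → (Fin N → Y) → Y → ℝ)
    (f : Fin n → Fin N) (g : (Fin N → Y) → Y → Y) :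
    (Fin n → X) → (Fin n → Y) → Y → ℝ :=
  fun a b c => ∑ xs : Fin N → X, ∑ ys : Fin N → Y, ∑ y0 : Y,
    if (fun t => xs (f t)) = a ∧ (fun t => ys (f t)) = b ∧ g ys y0 = c
    then μ xs ys y0 else 0

theorem block_lt {n k : ℕ} (i t : Fin n) (j : Fin k) :
    j.val * n + i.val + t.val < k * n + n - 1 := by
  have h1 : j.val * n + n ≤ k * n := by
    calc j.val * n + n = (j.val + 1) * n := by ring
    _ ≤ k * n := Nat.mul_le_mul_right n j.isLt
  have h2 : i.val < n := i.isLt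
  have h3 : t.val < n := t.isLt
  exact Nat.lt_sub_of_add_lt (by linarith)

/-- marginal pmf of a random variable -/
def pm {Ω α : Type*} [Fintype Ω] [DecidableEq α] (p : Ω → ℝ) (U : Ω → α) (u : α) : ℝ :=
  ∑ ω, if U ω = u then p ω else 0

/-- entropy of a random variable -/
def Ent {Ω α : Type*} [Fintype Ω] [DecidableEq α] (p : Ω → ℝ) (U : Ω → α) : ℝ :=
  -∑ ω, p ω * Real.log (pm p U (U ω))

theorem pm_nonneg {Ω α : Type*} [Fintype Ω] [DecidableEq α] {p : Ω → ℝ} (hp : ∀ ω, 0 ≤ p ω)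
    (U : Ω → α) (u : α) : 0 ≤ pm p U u :=
  Finset.sum_nonneg fun ω _ => by split_ifs <;> simp [hp]

theorem pm_ge {Ω α : Type*} [Fintype Ω] [DecidableEq α] {p : Ω → ℝ} (hp : ∀ ω, 0 ≤ p ω)
    (U : Ω → α) (ω : Ω) : p ω ≤ pm p U (U ω) := by
  unfold pm
  have := Finset.single_le_sum (f := fun ω' => if U ω' = U ω then p ω' else 0)
    (fun ω' _ => by split_ifs <;> simp [hp]) (Finset.mem_univ ω)
  simpa using this

theorem sum_pm_mul {Ω α : Type*} [Fintype Ω] [Fintype α] [DecidableEq α] (p : Ω → ℝ)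
    (U : Ω → α) (g : α → ℝ) : ∑ u, pm p U u * g u = ∑ ω, p ω * g (U ω) := by
  unfold pm
  simp_rw [Finset.sum_mul]
  rw [Finset.sum_comm]
  refine Finset.sum_congr rfl fun ω _ => ?_
  simp [ite_mul]

theorem sum_pm {Ω α : Type*} [Fintype Ω] [Fintype α] [DecidableEq α] (p : Ω → ℝ)
    (U : Ω → α) : ∑ u, pm p U u = ∑ ω, p ω := by
  simpa using sum_pm_mul p U (fun _ => 1)

theorem pm_comp {Ω α β : Type*} [Fintype Ω] [Fintype α] [DecidableEq α] [DecidableEq β]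
    (p : Ω → ℝ) (U : Ω → α) (f : α → β) (b : β) :
    ∑ u, (if f u = b then pm p U u else 0) = pm p (fun ω => f (U ω)) b := by
  have := sum_pm_mul p U (fun u => if f u = b then 1 else 0)
  simpa [pm] using this

theorem Ent_congr {Ω α β : Type*} [Fintype Ω] [DecidableEq α] [DecidableEq β] (p : Ω → ℝ)
    (U : Ω → α) (V : Ω → β) (h : ∀ ω ω', U ω = U ω' ↔ V ω = V ω') : Ent p U = Ent p V := by
  unfold Ent pm
  simp_rw [h]

theorem gibbs {Ω β : Type*} [Fintype Ω] [Fintype β] [DecidableEq β] {p : Ω → ℝ}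
    (hp : ∀ ω, 0 ≤ p ω) (h1 : ∑ ω, p ω = 1) (V : Ω → β) (r : β → ℝ) (hr : ∀ b, 0 ≤ r b)
    (hs : ∑ b, r b ≤ 1) (hpos : ∀ ω, 0 < p ω → 0 < r (V ω)) :
    ∑ ω, p ω * Real.log (r (V ω)) + Ent p V ≤ 0 := by
  have key : ∀ ω, p ω * Real.log (r (V ω)) - p ω * Real.log (pm p V (V ω))
      ≤ p ω * (r (V ω) / pm p V (V ω)) - p ω := by
    intro ω
    rcases (hp ω).eq_or_lt with h | h
    · simp [← h]
    · have hm : 0 < pm p V (V ω) := lt_of_lt_of_le h (pm_ge hp V ω)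
      have hr' := hpos ω h
      have := Real.log_le_sub_one_of_pos (div_pos hr' hm)
      rw [Real.log_div hr'.ne' hm.ne'] at this
      nlinarith
  have h2 : ∑ ω, p ω * (r (V ω) / pm p V (V ω)) ≤ 1 := by
    rw [← sum_pm_mul p V (fun b => r b / pm p V b)]
    refine le_trans (Finset.sum_le_sum fun b _ => ?_) hs
    rcases (pm_nonneg hp V b).eq_or_lt with h | h
    · simp [← h, hr b]
    · exact le_of_eq (mul_div_cancel₀ _ h.ne')
  have h3 := Finset.sum_le_sum (s := Finset.univ) fun ω _ => key ω
  simp only [Finset.sum_sub_distrib] at h3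
  unfold Ent
  linarith

theorem ssa {Ω α β γ : Type*} [Fintype Ω] [Fintype α] [Fintype β] [DecidableEq α]
    [DecidableEq β] [DecidableEq γ] {p : Ω → ℝ}
    (hp : ∀ ω, 0 ≤ p ω) (h1 : ∑ ω, p ω = 1) (A : Ω → α) (B : Ω → β) (C : Ω → γ)
    (f : α → γ) (g : β → γ) (hf : ∀ ω, f (A ω) = C ω) (hg : ∀ ω, g (B ω) = C ω) :
    Ent p (fun ω => (A ω, B ω)) + Ent p C ≤ Ent p A + Ent p B := by
  have hG := gibbs hp h1 (fun ω => (A ω, B ω))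
    (fun x => if g x.2 = f x.1 then pm p A x.1 * pm p B x.2 / pm p C (f x.1) else 0)
    (fun x => by
      split_ifs
      · exact div_nonneg (mul_nonneg (pm_nonneg hp _ _) (pm_nonneg hp _ _)) (pm_nonneg hp _ _)
      · exact le_rfl)
    (by
      rw [Fintype.sum_prod_type, ← h1, ← sum_pm p A]
      refine Finset.sum_le_sum fun a _ => ?_
      have : ∀ b, (if g b = f a then pm p A a * pm p B b / pm p C (f a) else 0)
          = pm p A a / pm p C (f a) * (if g b = f a then pm p B b else 0) := by
        intro b; split_ifs <;> ring
      simp only [this]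
      rw [← Finset.mul_sum, pm_comp]
      have hC : (fun ω => g (B ω)) = C := funext hg
      rw [hC]
      rcases (pm_nonneg hp C (f a)).eq_or_lt with h | h
      · simp [← h, pm_nonneg hp]
      · rw [div_mul_cancel₀ _ h.ne'])
    (fun ω h => by
      simp only [hf, hg, if_true]
      have := lt_of_lt_of_le h (pm_ge hp A ω)
      have := lt_of_lt_of_le h (pm_ge hp B ω)
      have := lt_of_lt_of_le h (pm_ge hp C ω)
      positivity)
  have e : ∑ ω, p ω * Real.log (if g (A ω, B ω).2 = f (A ω, B ω).1 then
      pm p A (A ω, B ω).1 * pm p B (A ω, B ω).2 / pm p C (f (A ω, B ω).1) else 0)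
      = -Ent p A - Ent p B + Ent p C := by
    simp only [Ent, neg_neg, sub_neg_eq_add, ← Finset.sum_add_distrib, ← sub_eq_add_neg,
      ← Finset.sum_sub_distrib]
    refine Finset.sum_congr rfl fun ω _ => ?_
    simp only [hf, hg, if_true]
    rcases (hp ω).eq_or_lt with h | h
    · simp [← h]
    · have h1 := lt_of_lt_of_le h (pm_ge hp A ω)
      have h2 := lt_of_lt_of_le h (pm_ge hp B ω)
      have h3 := lt_of_lt_of_le h (pm_ge hp C ω)
      rw [Real.log_div (by positivity) (by positivity), Real.log_mul h1.ne' h2.ne']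
      ring
  rw [e] at hG
  linarith

/-- The conditional mutual information in terms of entropies. -/
theorem condMI_eq {Ω A B C : Type*} [Fintype Ω] [Fintype A] [Fintype B] [Fintype C]
    [DecidableEq A] [DecidableEq B] [DecidableEq C] {p : Ω → ℝ} (hp : ∀ ω, 0 ≤ p ω)
    (U : Ω → A) (V : Ω → B) (W : Ω → C) (M : A → B → C → ℝ)
    (hM : ∀ a b c, M a b c = pm p (fun ω => (U ω, V ω, W ω)) (a, b, c)) :
    condMI M = Ent p (fun ω => (U ω, W ω)) + Ent p (fun ω => (V ω, W ω))
      - Ent p (fun ω => (U ω, V ω, W ω)) - Ent p W := by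
  have e1 : ∀ c, ∑ a, ∑ b, M a b c = pm p W c := by
    intro c
    have := pm_comp p (fun ω => (U ω, V ω, W ω)) (fun x => x.2.2) c
    rw [← this]
    simp [Fintype.sum_prod_type, hM]
  have e2 : ∀ a c, ∑ b, M a b c = pm p (fun ω => (U ω, W ω)) (a, c) := by
    intro a c
    have := pm_comp p (fun ω => (U ω, V ω, W ω)) (fun x => (x.1, x.2.2)) (a, c)
    rw [← this]
    simp [Fintype.sum_prod_type, hM, ite_and, Finset.sum_ite_irrel]
  have e3 : ∀ b c, ∑ a, M a b c = pm p (fun ω => (V ω, W ω)) (b, c) := by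
    intro b c
    have := pm_comp p (fun ω => (U ω, V ω, W ω)) (fun x => (x.2.1, x.2.2)) (b, c)
    rw [← this]
    simp [Fintype.sum_prod_type, hM, ite_and, Finset.sum_ite_irrel]
  unfold condMI
  simp only [e1]
  simp only [e2, e3]
  have := sum_pm_mul p (fun ω => (U ω, V ω, W ω)) (fun x =>
    Real.log (pm p (fun ω => (U ω, V ω, W ω)) x * pm p W x.2.2 /
      (pm p (fun ω => (U ω, W ω)) (x.1, x.2.2) * pm p (fun ω => (V ω, W ω)) (x.2.1, x.2.2))))
  simp only [Fintype.sum_prod_type] at this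
  simp only [hM]
  rw [this]
  simp only [Ent, sub_neg_eq_add, ← sub_eq_add_neg, ← Finset.sum_neg_distrib,
    ← Finset.sum_sub_distrib, ← Finset.sum_add_distrib]
  refine Finset.sum_congr rfl fun ω _ => ?_
  rcases (hp ω).eq_or_lt with h | h
  · simp [← h]
  · have h1 := lt_of_lt_of_le h (pm_ge hp (fun ω => (U ω, W ω)) ω)
    have h2 := lt_of_lt_of_le h (pm_ge hp (fun ω => (V ω, W ω)) ω)
    have h3 := lt_of_lt_of_le h (pm_ge hp (fun ω => (U ω, V ω, W ω)) ω)
    have h4 := lt_of_lt_of_le h (pm_ge hp W ω)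
    rw [Real.log_div (by positivity) (by positivity), Real.log_mul h3.ne' h4.ne',
      Real.log_mul h1.ne' h2.ne']
    ring

theorem sum_chain {X Y : Type*} [Fintype X] [Fintype Y] (Q : X → Y → Y → ℝ) (hQ : IsPOST Q)
    (l : ℕ) (x : Fin l → X) (g : Y → ℝ) :
    ∑ y : Fin (l + 1) → Y, g (y 0) * ∏ s : Fin l, Q (x s) (y s.castSucc) (y s.succ)
      = ∑ c, g c := by
  induction l with
  | zero =>
    simp only [Finset.univ_eq_empty, Finset.prod_empty, mul_one]
    exact Fintype.sum_equiv (Equiv.funUnique (Fin 1) Y) _ _ (fun y => rfl)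
  | succ l ih =>
    rw [← (Fin.snocEquiv (fun _ => Y)).sum_comp, Fintype.sum_prod_type, Finset.sum_comm]
    rw [← ih (fun s => x s.castSucc)]
    refine Finset.sum_congr rfl fun y _ => ?_
    have : ∀ c : Y, g (Fin.snocEquiv (fun _ => Y) (c, y) 0) *
        ∏ s : Fin (l + 1), Q (x s) (Fin.snocEquiv (fun _ => Y) (c, y) s.castSucc)
          (Fin.snocEquiv (fun _ => Y) (c, y) s.succ)
        = (g (y 0) * ∏ s : Fin l, Q (x s.castSucc) (y s.castSucc) (y s.succ)) *
          Q (x (Fin.last l)) (y (Fin.last l)) c := by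
      intro c
      have h0 : Fin.snocEquiv (fun _ => Y) (c, y) 0 = y 0 := by
        have := Fin.snoc_castSucc (α := fun _ => Y) c y 0
        simpa [Fin.snocEquiv] using this
      rw [Fin.prod_univ_castSucc, h0, mul_assoc]
      simp only [Fin.snocEquiv, Equiv.coe_fn_mk, Fin.succ_last]
      simp only [Fin.snoc_last, Fin.snoc_castSucc, Fin.succ_castSucc]
    simp only [this]
    rw [← Finset.mul_sum, hQ.2, mul_one]

section chain

variable {Ω X Y : Type*} [Fintype Ω] [Fintype X] [Fintype Y] [DecidableEq X] [DecidableEq Y]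

/-- block of a sequence of random variables -/
def blk {α : Type*} (Z : ℕ → Ω → α) (a l : ℕ) (ω : Ω) : Fin l → α := fun s => Z (a + s) ω

/-- the functional whose subadditivity is used -/
def Fn (p : Ω → ℝ) (Q : X → Y → Y → ℝ) (Xs : ℕ → Ω → X) (Z : ℕ → Ω → Y) (a l : ℕ) : ℝ :=
  ∑ ω, p ω * ∑ s ∈ Finset.range l, Real.log (Q (Xs (a + s) ω) (Z (a + s) ω) (Z (a + s + 1) ω))
    + Ent p (blk Z a (l + 1)) - Ent p (Z a)

theorem blk_eq_iff {α : Type*} (Z : ℕ → Ω → α) (a l : ℕ) (ω ω' : Ω) :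
    blk Z a l ω = blk Z a l ω' ↔ ∀ s < l, Z (a + s) ω = Z (a + s) ω' := by
  constructor
  · intro h s hs
    exact congrFun h ⟨s, hs⟩
  · intro h
    funext s
    exact h s s.2

theorem Fn_add {p : Ω → ℝ} (hp : ∀ ω, 0 ≤ p ω) (h1 : ∑ ω, p ω = 1)
    (Q : X → Y → Y → ℝ) (Xs : ℕ → Ω → X) (Z : ℕ → Ω → Y) (a l m : ℕ) :
    Fn p Q Xs Z a (l + m) ≤ Fn p Q Xs Z a l + Fn p Q Xs Z (a + l) m := by
  have h := ssa hp h1 (blk Z a (l + 1)) (blk Z (a + l) (m + 1)) (Z (a + l))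
    (fun y => y (Fin.last l)) (fun y => y 0) (fun ω => rfl) (fun ω => rfl)
  have e : Ent p (blk Z a (l + m + 1)) =
      Ent p (fun ω => (blk Z a (l + 1) ω, blk Z (a + l) (m + 1) ω)) := by
    apply Ent_congr
    intro ω ω'
    simp only [Prod.mk.injEq, blk_eq_iff]
    constructor
    · intro h
      refine ⟨fun s hs => h s (by omega), fun s hs => ?_⟩
      rw [add_assoc]
      exact h (l + s) (by omega)
    · rintro ⟨h1, h2⟩ s hs
      by_cases hsl : s < l + 1
      · exact h1 s hsl
      · have := h2 (s - l) (by omega)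
        rwa [show a + l + (s - l) = a + s by omega] at this
  unfold Fn
  simp only [Finset.sum_range_add, mul_add, Finset.sum_add_distrib, ← add_assoc]
  rw [e]
  linarith

theorem Fn_zero (p : Ω → ℝ) (Q : X → Y → Y → ℝ) (Xs : ℕ → Ω → X) (Z : ℕ → Ω → Y) (a : ℕ) :
    Fn p Q Xs Z a 0 = 0 := by
  have e : Ent p (blk Z a 1) = Ent p (Z a) := by
    apply Ent_congr
    intro ω ω'
    simp [blk_eq_iff]
  simp [Fn, e]

theorem Fn_le {p : Ω → ℝ} (hp : ∀ ω, 0 ≤ p ω) (h1 : ∑ ω, p ω = 1)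
    (Q : X → Y → Y → ℝ) (hQ : IsPOST Q) (Xs : ℕ → Ω → X) (Z : ℕ → Ω → Y) (N : ℕ)
    (hpos : ∀ ω, 0 < p ω → ∀ t < N, 0 < Q (Xs t ω) (Z t ω) (Z (t + 1) ω))
    (a l : ℕ) (hal : a + l ≤ N) :
    Fn p Q Xs Z a l ≤ Ent p (fun ω => (blk Xs a l ω, Z a ω)) + Ent p (blk Z a (l + 1))
      - Ent p (fun ω => (blk Xs a l ω, blk Z a (l + 1) ω)) - Ent p (Z a) := by
  have hprod : ∀ ω, 0 < p ω → ∀ s : Fin l,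
      0 < Q (Xs (a + s) ω) (Z (a + s) ω) (Z (a + s + 1) ω) := fun ω h s =>
    hpos ω h (a + s) (by have := s.2; omega)
  have hG := gibbs hp h1 (fun ω => (blk Xs a l ω, blk Z a (l + 1) ω))
    (fun v => pm p (fun ω => (blk Xs a l ω, Z a ω)) (v.1, v.2 0) *
      ∏ s : Fin l, Q (v.1 s) (v.2 s.castSucc) (v.2 s.succ))
    (fun v => mul_nonneg (pm_nonneg hp _ _) (Finset.prod_nonneg fun s _ => hQ.1 _ _ _))
    (by
      rw [Fintype.sum_prod_type]
      have : ∀ x : Fin l → X, _ := fun x => sum_chain Q hQ l x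
        (fun c => pm p (fun ω => (blk Xs a l ω, Z a ω)) (x, c))
      simp only [this]
      rw [← Fintype.sum_prod_type
        (f := fun v => pm p (fun ω => (blk Xs a l ω, Z a ω)) v), sum_pm, h1])
    (fun ω h => mul_pos (lt_of_lt_of_le h (pm_ge hp (fun ω => (blk Xs a l ω, Z a ω)) ω))
      (Finset.prod_pos fun s _ => hprod ω h s))
  have e : ∀ ω, p ω * Real.log (pm p (fun ω => (blk Xs a l ω, Z a ω))
        (blk Xs a l ω, blk Z a (l + 1) ω 0) *
      ∏ s : Fin l, Q (blk Xs a l ω s) (blk Z a (l + 1) ω s.castSucc) (blk Z a (l + 1) ω s.succ))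
      = p ω * Real.log (pm p (fun ω => (blk Xs a l ω, Z a ω)) (blk Xs a l ω, Z a ω))
        + p ω * ∑ s ∈ Finset.range l,
          Real.log (Q (Xs (a + s) ω) (Z (a + s) ω) (Z (a + s + 1) ω)) := by
    intro ω
    rcases (hp ω).eq_or_lt with h | h
    · simp [← h]
    · have hh := lt_of_lt_of_le h (pm_ge hp (fun ω => (blk Xs a l ω, Z a ω)) ω)
      have hh2 : 0 < ∏ s : Fin l, Q (blk Xs a l ω s) (blk Z a (l + 1) ω s.castSucc)
          (blk Z a (l + 1) ω s.succ) := Finset.prod_pos fun s _ => hprod ω h s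
      rw [← mul_add]
      congr 1
      rw [show blk Z a (l + 1) ω 0 = Z a ω from rfl, Real.log_mul hh.ne' hh2.ne',
        Real.log_prod (fun s _ => ne_of_gt (show 0 < Q (blk Xs a l ω s)
          (blk Z a (l + 1) ω s.castSucc) (blk Z a (l + 1) ω s.succ) from hprod ω h s)),
        ← Fin.sum_univ_eq_sum_range (fun s =>
          Real.log (Q (Xs (a + s) ω) (Z (a + s) ω) (Z (a + s + 1) ω)))]
      rfl
  simp only [e, Finset.sum_add_distrib] at hG
  have e2 : Ent p (fun ω => (blk Xs a l ω, Z a ω)) =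
    -∑ ω, p ω * Real.log (pm p (fun ω => (blk Xs a l ω, Z a ω)) (blk Xs a l ω, Z a ω)) := rfl
  unfold Fn
  linarith

theorem Fn_one_le {p : Ω → ℝ} (hp : ∀ ω, 0 ≤ p ω) (h1 : ∑ ω, p ω = 1)
    (hX : 0 < Fintype.card X)
    (Q : X → Y → Y → ℝ) (hQ : IsPOST Q) (Xs : ℕ → Ω → X) (Z : ℕ → Ω → Y) (N : ℕ)
    (hpos : ∀ ω, 0 < p ω → ∀ t < N, 0 < Q (Xs t ω) (Z t ω) (Z (t + 1) ω))
    (a : ℕ) (hal : a + 1 ≤ N) :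
    Fn p Q Xs Z a 1 ≤ Real.log (Fintype.card X) := by
  have hF := Fn_le hp h1 Q hQ Xs Z N hpos a 1 hal
  have hc : (0 : ℝ) < Fintype.card X := by exact_mod_cast hX
  have hmono : Ent p (blk Z a (1 + 1)) ≤ Ent p (fun ω => (blk Xs a 1 ω, blk Z a (1 + 1) ω)) := by
    unfold Ent
    apply neg_le_neg
    refine Finset.sum_le_sum fun ω _ => ?_
    rcases (hp ω).eq_or_lt with h | h
    · simp [← h]
    · have hh := lt_of_lt_of_le h (pm_ge hp (fun ω => (blk Xs a 1 ω, blk Z a (1 + 1) ω)) ω)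
      refine mul_le_mul_of_nonneg_left (Real.log_le_log hh ?_) h.le
      unfold pm
      refine Finset.sum_le_sum fun ω' _ => ?_
      simp only [Prod.mk.injEq]
      have := hp ω'
      split_ifs <;> simp_all
  have hG := gibbs hp h1 (fun ω => (Xs a ω, Z a ω))
    (fun v => pm p (Z a) v.2 / Fintype.card X)
    (fun v => div_nonneg (pm_nonneg hp _ _) hc.le)
    (by
      rw [Fintype.sum_prod_type]
      simp only [← Finset.sum_div, sum_pm, h1, Finset.sum_const, Finset.card_univ, nsmul_eq_mul]
      rw [mul_one, div_self hc.ne'])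
    (fun ω h => div_pos (lt_of_lt_of_le h (pm_ge hp (Z a) ω)) hc)
  have e : ∀ ω, p ω * Real.log (pm p (Z a) (Z a ω) / Fintype.card X) =
      p ω * Real.log (pm p (Z a) (Z a ω)) - p ω * Real.log (Fintype.card X) := by
    intro ω
    rcases (hp ω).eq_or_lt with h | h
    · simp [← h]
    · rw [Real.log_div (lt_of_lt_of_le h (pm_ge hp (Z a) ω)).ne' hc.ne', mul_sub]
  simp only [e, Finset.sum_sub_distrib, ← Finset.sum_mul, h1] at hG
  have e2 : Ent p (fun ω => (blk Xs a 1 ω, Z a ω)) = Ent p (fun ω => (Xs a ω, Z a ω)) := by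
    apply Ent_congr
    intro ω ω'
    simp [blk_eq_iff]
  have e3 : Ent p (Z a) = -∑ ω, p ω * Real.log (pm p (Z a) (Z a ω)) := rfl
  linarith

theorem Fn_le_mul {p : Ω → ℝ} (hp : ∀ ω, 0 ≤ p ω) (h1 : ∑ ω, p ω = 1)
    (hX : 0 < Fintype.card X)
    (Q : X → Y → Y → ℝ) (hQ : IsPOST Q) (Xs : ℕ → Ω → X) (Z : ℕ → Ω → Y) (N : ℕ)
    (hpos : ∀ ω, 0 < p ω → ∀ t < N, 0 < Q (Xs t ω) (Z t ω) (Z (t + 1) ω))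
    (a l : ℕ) (hal : a + l ≤ N) :
    Fn p Q Xs Z a l ≤ l * Real.log (Fintype.card X) := by
  induction l with
  | zero => simp [Fn_zero]
  | succ l ih =>
    have := Fn_add hp h1 Q Xs Z a l 1
    have h2 := Fn_one_le hp h1 hX Q hQ Xs Z N hpos (a + l) (by omega)
    have h3 := ih (by omega)
    push_cast
    linarith

theorem Fn_blocks {p : Ω → ℝ} (hp : ∀ ω, 0 ≤ p ω) (h1 : ∑ ω, p ω = 1)
    (Q : X → Y → Y → ℝ) (Xs : ℕ → Ω → X) (Z : ℕ → Ω → Y) (a n k : ℕ) :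
    Fn p Q Xs Z a (k * n) ≤ ∑ j ∈ Finset.range k, Fn p Q Xs Z (j * n + a) n := by
  induction k with
  | zero => simp [Fn_zero]
  | succ k ih =>
    have := Fn_add hp h1 Q Xs Z a (k * n) n
    rw [Finset.sum_range_succ, add_mul, one_mul, add_comm (k * n) a]
    linarith

theorem Fn_total {p : Ω → ℝ} (hp : ∀ ω, 0 ≤ p ω) (h1 : ∑ ω, p ω = 1)
    (hX : 0 < Fintype.card X)
    (Q : X → Y → Y → ℝ) (hQ : IsPOST Q) (Xs : ℕ → Ω → X) (Z : ℕ → Ω → Y) (n k : ℕ)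
    (hpos : ∀ ω, 0 < p ω → ∀ t < k * n + n - 1, 0 < Q (Xs t ω) (Z t ω) (Z (t + 1) ω))
    (i : ℕ) (hi : i < n) :
    Fn p Q Xs Z 0 (k * n + n - 1) ≤ ((n : ℝ) - 1) * Real.log (Fintype.card X) +
      ∑ j ∈ Finset.range k, Fn p Q Xs Z (j * n + i) n := by
  have e : k * n + n - 1 = i + (k * n + (n - 1 - i)) := by omega
  have a1 := Fn_add hp h1 Q Xs Z 0 i (k * n + (n - 1 - i))
  have a2 := Fn_add hp h1 Q Xs Z (0 + i) (k * n) (n - 1 - i)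
  have a3 := Fn_blocks hp h1 Q Xs Z i n k
  have a4 := Fn_le_mul hp h1 hX Q hQ Xs Z _ hpos 0 i (by omega)
  have a5 := Fn_le_mul hp h1 hX Q hQ Xs Z _ hpos (0 + i + k * n) (n - 1 - i) (by omega)
  have a6 : ((n - 1 - i : ℕ) : ℝ) = (n : ℝ) - 1 - i := by
    rw [Nat.cast_sub (by omega), Nat.cast_sub (by omega), Nat.cast_one]
  rw [a6] at a5
  rw [e]
  simp only [zero_add] at *
  linarith

end chain

section concrete

variable {X Y : Type*} [Fintype X] [Fintype Y] [DecidableEq X] [DecidableEq Y]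

/-- the input sequence as random variables -/
def Xr (N : ℕ) (x0 : X) (t : ℕ) (ω : (Fin N → X) × (Fin N → Y) × Y) : X :=
  if h : t < N then ω.1 ⟨t, h⟩ else x0

/-- the state sequence as random variables -/
def Zr (N : ℕ) (t : ℕ) (ω : (Fin N → X) × (Fin N → Y) × Y) : Y :=
  if t = 0 then ω.2.2 else if h : t - 1 < N then ω.2.1 ⟨t - 1, h⟩ else ω.2.2

/-- the law on the product -/
def lawr (Q : X → Y → Y → ℝ) (N : ℕ) (P : (Fin N → X) → Y → ℝ)
    (ω : (Fin N → X) × (Fin N → Y) × Y) : ℝ := nLaw Q N P ω.1 ω.2.1 ω.2.2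

theorem prevState_eq (N : ℕ) (ω : (Fin N → X) × (Fin N → Y) × Y) (t : Fin N) :
    prevState N ω.2.2 ω.2.1 t = Zr N t ω := by
  unfold prevState Zr
  have := t.2
  split_ifs with h1 h2
  · rfl
  · rfl
  · omega

theorem lawr_eq (Q : X → Y → Y → ℝ) (N : ℕ) (P : (Fin N → X) → Y → ℝ) (x0 : X)
    (ω : (Fin N → X) × (Fin N → Y) × Y) :
    lawr Q N P ω = P ω.1 ω.2.2 * ∏ t ∈ Finset.range N,
      Q (Xr N x0 t ω) (Zr N t ω) (Zr N (t + 1) ω) := by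
  unfold lawr nLaw
  rw [← Fin.prod_univ_eq_prod_range (fun t => Q (Xr N x0 t ω) (Zr N t ω) (Zr N (t + 1) ω))]
  congr 1
  refine Finset.prod_congr rfl fun t _ => ?_
  rw [prevState_eq]
  simp [Xr, Zr]

theorem sum_lawr_y (Q : X → Y → Y → ℝ) (hQ : IsPOST Q) (N : ℕ) (x : Fin N → X) (c : Y) :
    ∑ ys : Fin N → Y, ∏ t : Fin N, Q (x t) (prevState N c ys t) (ys t) = 1 := by
  have h := sum_chain Q hQ N x (fun y => if y = c then 1 else 0)
  rw [← (Fin.consEquiv (fun _ => Y)).sum_comp, Fintype.sum_prod_type] at h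
  simp only [Fin.consEquiv, Equiv.coe_fn_mk, Fin.cons_zero, Fin.cons_succ, ite_mul, one_mul,
    zero_mul, Finset.sum_ite_irrel, Finset.sum_const_zero, Finset.sum_ite_eq', Finset.mem_univ,
    if_true] at h
  rw [← h]
  refine Finset.sum_congr rfl fun ys _ => Finset.prod_congr rfl fun t _ => ?_
  congr 1
  unfold prevState
  rcases t with ⟨t, ht⟩
  cases t with
  | zero => rfl
  | succ t => rfl

theorem lawr_nonneg (Q : X → Y → Y → ℝ) (hQ : IsPOST Q) (N : ℕ) (P : (Fin N → X) → Y → ℝ)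
    (hP : IsJointPmfN N P) (ω : (Fin N → X) × (Fin N → Y) × Y) : 0 ≤ lawr Q N P ω :=
  mul_nonneg (hP.1 _ _) (Finset.prod_nonneg fun _ _ => hQ.1 _ _ _)

theorem lawr_sum (Q : X → Y → Y → ℝ) (hQ : IsPOST Q) (N : ℕ) (P : (Fin N → X) → Y → ℝ)
    (hP : IsJointPmfN N P) : ∑ ω, lawr Q N P ω = 1 := by
  rw [Fintype.sum_prod_type, ← hP.2]
  refine Finset.sum_congr rfl fun xs _ => ?_
  rw [Fintype.sum_prod_type, Finset.sum_comm]
  refine Finset.sum_congr rfl fun c _ => ?_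
  simp only [lawr, nLaw]
  rw [← Finset.mul_sum, sum_lawr_y Q hQ, mul_one]

theorem lawr_pos (Q : X → Y → Y → ℝ) (hQ : IsPOST Q) (N : ℕ) (P : (Fin N → X) → Y → ℝ)
    (x0 : X) (ω : (Fin N → X) × (Fin N → Y) × Y) (h : 0 < lawr Q N P ω)
    (t : ℕ) (ht : t < N) : 0 < Q (Xr N x0 t ω) (Zr N t ω) (Zr N (t + 1) ω) := by
  refine lt_of_le_of_ne (hQ.1 _ _ _) fun h0 => h.ne' ?_
  rw [lawr_eq Q N P x0, Finset.prod_eq_zero (Finset.mem_range.2 ht) h0.symm, mul_zero]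

theorem pm_lawr_xy (Q : X → Y → Y → ℝ) (hQ : IsPOST Q) (N : ℕ) (P : (Fin N → X) → Y → ℝ)
    (x : Fin N → X) (c : Y) :
    pm (lawr Q N P) (fun ω => (ω.1, ω.2.2)) (x, c) = P x c := by
  unfold pm
  rw [Fintype.sum_prod_type]
  simp only [Fintype.sum_prod_type, Prod.mk.injEq, ite_and, Finset.sum_ite_irrel,
    Finset.sum_const_zero, Finset.sum_ite_eq', Finset.mem_univ, if_true, lawr, nLaw]
  rw [← Finset.mul_sum, sum_lawr_y Q hQ, mul_one]

theorem condMI_nLaw_le (Q : X → Y → Y → ℝ) (hQ : IsPOST Q) (N : ℕ) (P : (Fin N → X) → Y → ℝ)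
    (hP : IsJointPmfN N P) (x0 : X) :
    condMI (nLaw Q N P) = Fn (lawr Q N P) Q (Xr N x0) (Zr N) 0 N := by
  have hp := lawr_nonneg Q hQ N P hP
  have hpt : ∀ v, pm (lawr Q N P) (fun ω => (ω.1, ω.2.1, ω.2.2)) v = lawr Q N P v := by
    intro v
    simp [pm]
  rw [condMI_eq hp (fun ω => ω.1) (fun ω => ω.2.1) (fun ω => ω.2.2) (nLaw Q N P)
    (fun a b c => (hpt (a, b, c)).symm)]
  have e1 : Ent (lawr Q N P) (fun ω => (ω.2.1, ω.2.2)) =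
      Ent (lawr Q N P) (blk (Zr N) 0 (N + 1)) := by
    apply Ent_congr
    intro ω ω'
    simp only [Prod.mk.injEq, blk_eq_iff, zero_add]
    constructor
    · rintro ⟨h1, h2⟩ s hs
      simp only [Zr, h1, h2]
    · intro h
      have h0 := h 0 (by omega)
      refine ⟨funext fun t => ?_, by simpa [Zr] using h0⟩
      have := h (t + 1) (by omega)
      simpa [Zr] using this
  have e2 : Ent (lawr Q N P) (fun ω => ω.2.2) = Ent (lawr Q N P) (Zr N 0) := by
    apply Ent_congr
    intro ω ω'
    simp [Zr]
  have e3 : Ent (lawr Q N P) (fun ω => (ω.1, ω.2.2)) -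
      Ent (lawr Q N P) (fun ω => (ω.1, ω.2.1, ω.2.2)) =
      ∑ ω, lawr Q N P ω * ∑ s ∈ Finset.range N,
        Real.log (Q (Xr N x0 (0 + s) ω) (Zr N (0 + s) ω) (Zr N (0 + s + 1) ω)) := by
    simp only [Ent, hpt, sub_neg_eq_add]
    rw [neg_add_eq_sub, ← Finset.sum_sub_distrib]
    refine Finset.sum_congr rfl fun ω _ => ?_
    rcases (hp ω).eq_or_lt with h | h
    · simp [← h]
    · rw [pm_lawr_xy Q hQ, ← mul_sub]
      congr 1
      have hpos := lawr_pos Q hQ N P x0 ω h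
      simp only [zero_add]
      rw [← Real.log_prod fun s hs => (hpos s (Finset.mem_range.1 hs)).ne']
      have hpr : 0 < ∏ t ∈ Finset.range N, Q (Xr N x0 t ω) (Zr N t ω) (Zr N (t + 1) ω) :=
        Finset.prod_pos fun s hs => hpos s (Finset.mem_range.1 hs)
      have hPP : P ω.1 ω.2.2 ≠ 0 := by
        intro h0
        apply h.ne'
        rw [lawr_eq Q N P x0, h0, zero_mul]
      change Real.log (lawr Q N P ω) - _ = _
      rw [lawr_eq Q N P x0, Real.log_mul hPP hpr.ne']
      ring
  unfold Fn
  rw [e1, e2, ← e3]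
  ring

theorem condMI_block_ge (Q : X → Y → Y → ℝ) (hQ : IsPOST Q) (N : ℕ) (P : (Fin N → X) → Y → ℝ)
    (hP : IsJointPmfN N P) (x0 : X) (a l : ℕ) (hal : a + l ≤ N)
    (f : Fin l → Fin N) (hf : ∀ t, (f t : ℕ) = a + t) (g : (Fin N → Y) → Y → Y)
    (hg : ∀ ω : (Fin N → X) × (Fin N → Y) × Y, g ω.2.1 ω.2.2 = Zr N a ω) :
    Fn (lawr Q N P) Q (Xr N x0) (Zr N) a l ≤ condMI (blockMarginal (nLaw Q N P) f g) := by
  have hp := lawr_nonneg Q hQ N P hP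
  have h1 := lawr_sum Q hQ N P hP
  refine (Fn_le hp h1 Q hQ (Xr N x0) (Zr N) N (lawr_pos Q hQ N P x0) a l hal).trans ?_
  rw [condMI_eq hp (fun ω t => ω.1 (f t)) (fun ω t => ω.2.1 (f t)) (fun ω => g ω.2.1 ω.2.2)
    (blockMarginal (nLaw Q N P) f g) (fun a b c => by
      simp only [blockMarginal, pm, Fintype.sum_prod_type, Prod.mk.injEq, lawr])]
  have hx : ∀ ω ω' : (Fin N → X) × (Fin N → Y) × Y,
      ((fun t => ω.1 (f t)) = fun t => ω'.1 (f t)) ↔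
        blk (Xr N x0) a l ω = blk (Xr N x0) a l ω' := by
    intro ω ω'
    rw [blk_eq_iff, funext_iff]
    have key : ∀ (ω : (Fin N → X) × (Fin N → Y) × Y) (t : Fin l),
        ω.1 (f t) = Xr N x0 (a + t) ω := by
      intro ω t
      have : a + (t : ℕ) < N := by have := t.2; omega
      rw [Xr, dif_pos this]
      exact congrArg ω.1 (Fin.ext (hf t))
    simp only [key]
    exact ⟨fun h s hs => h ⟨s, hs⟩, fun h t => h t t.2⟩
  have hy : ∀ ω ω' : (Fin N → X) × (Fin N → Y) × Y,
      (((fun t => ω.2.1 (f t)) = fun t => ω'.2.1 (f t)) ∧ Zr N a ω = Zr N a ω') ↔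
        blk (Zr N) a (l + 1) ω = blk (Zr N) a (l + 1) ω' := by
    intro ω ω'
    rw [blk_eq_iff, funext_iff]
    have key : ∀ (ω : (Fin N → X) × (Fin N → Y) × Y) (t : Fin l),
        ω.2.1 (f t) = Zr N (a + (t + 1)) ω := by
      intro ω t
      have : a + ((t : ℕ) + 1) - 1 < N := by have := t.2; omega
      rw [Zr, if_neg (by omega), dif_pos this]
      exact congrArg ω.2.1 (Fin.ext (hf t))
    simp only [key]
    constructor
    · rintro ⟨h, h0⟩ s hs
      cases s with
      | zero => exact h0
      | succ s => exact h ⟨s, by omega⟩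
    · intro h
      exact ⟨fun t => h (t + 1) (by have := t.2; omega), h 0 (by omega)⟩
  simp only [hg]
  apply le_of_eq
  congr 1
  congr 1
  · congr 1
    · apply Ent_congr
      intro ω ω'
      simp only [Prod.mk.injEq, hx]
    · apply Ent_congr
      intro ω ω'
      simp only [Prod.mk.injEq, hy]
  · apply Ent_congr
    intro ω ω'
    simp only [Prod.mk.injEq, hx, hy]

end concrete


/-- For any POST channel `Q`, positive integers `n, k`, and any
joint input–initial-state pmf on `𝒳^{kn+n-1} × 𝒴`, under the induced joint law:
`n · I(X^{kn+n-1}; Y^{kn+n-1} | Y_0) ≤ n(n-1) log|𝒳| +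
∑_{i=1}^{n} ∑_{j=1}^{k} I(X_{(j-1)n+i}^{jn+i-1}; Y_{(j-1)n+i}^{jn+i-1} | Y_{(j-1)n+i-1})`.
(Blocks are indexed below by `i : Fin n`, `j : Fin k`, i.e., `0`-based.) -/
theorem block_decomposition_bound
    {X Y : Type*} [Fintype X] [Fintype Y] [DecidableEq X] [DecidableEq Y]
    (hX : 2 ≤ Fintype.card X) (hY : 2 ≤ Fintype.card Y)
    (Q : X → Y → Y → ℝ) (hQ : IsPOST Q)
    (n k : ℕ) (hn : 0 < n) (hk : 0 < k)
    (P : (Fin (k * n + n - 1) → X) → Y → ℝ) (hP : IsJointPmfN (k * n + n - 1) P) :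
    (n : ℝ) * condMI (nLaw Q (k * n + n - 1) P) ≤
      (n : ℝ) * ((n : ℝ) - 1) * Real.log (Fintype.card X) +
      ∑ i : Fin n, ∑ j : Fin k,
        condMI (blockMarginal (nLaw Q (k * n + n - 1) P)
          (fun t : Fin n => ⟨j.val * n + i.val + t.val, block_lt i t j⟩)
          (fun ys y0 =>
            if j.val * n + i.val = 0 then y0
            else ys ⟨j.val * n + i.val - 1,
              lt_of_le_of_lt (Nat.sub_le _ _) (by simpa using block_lt i ⟨0, i.pos⟩ j)⟩)) := by
  have hX0 : 0 < Fintype.card X := by omega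
  obtain ⟨x0⟩ : Nonempty X := Fintype.card_pos_iff.1 hX0
  have hp := lawr_nonneg Q hQ _ P hP
  have h1 := lawr_sum Q hQ _ P hP
  rw [condMI_nLaw_le Q hQ _ P hP x0]
  have hi : ∀ i : Fin n, Fn (lawr Q (k * n + n - 1) P) Q (Xr _ x0) (Zr _) 0 (k * n + n - 1) ≤
      ((n : ℝ) - 1) * Real.log (Fintype.card X) + ∑ j : Fin k,
        condMI (blockMarginal (nLaw Q (k * n + n - 1) P)
          (fun t : Fin n => ⟨j.val * n + i.val + t.val, block_lt i t j⟩)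
          (fun ys y0 =>
            if j.val * n + i.val = 0 then y0
            else ys ⟨j.val * n + i.val - 1,
              lt_of_le_of_lt (Nat.sub_le _ _) (by simpa using block_lt i ⟨0, i.pos⟩ j)⟩)) := by
    intro i
    refine (Fn_total hp h1 hX0 Q hQ (Xr _ x0) (Zr _) n k
      (lawr_pos Q hQ _ P x0) i i.2).trans ?_
    rw [← Fin.sum_univ_eq_sum_range (fun j => Fn (lawr Q (k * n + n - 1) P) Q (Xr _ x0) (Zr _)
      (j * n + i) n)]
    refine add_le_add le_rfl (Finset.sum_le_sum fun j _ => ?_)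
    have hl := block_lt i ⟨n - 1, by omega⟩ j
    simp only at hl
    refine condMI_block_ge Q hQ _ P hP x0 _ _ (by omega) _ (fun t => rfl) _ (fun ω => ?_)
    unfold Zr
    have h0 : j.val * n + i.val - 1 < k * n + n - 1 := by omega
    rw [dif_pos h0]
  have hs := Finset.sum_le_sum (s := Finset.univ) fun i _ => hi i
  rw [Finset.sum_add_distrib] at hs
  simp only [Finset.sum_const, Finset.card_univ, Fintype.card_fin, nsmul_eq_mul] at hs
  rw [mul_assoc]
  exact hs
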